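/- arXiv:1209.5325 — 2 statements merged into one kernel-verified Lean document; each statement's English description precedes it below -/
import Mathlib

section
/- The class of languages recognized by high-level TOPL automata is closed under concatenation: for any two hl-TOPL automata A₁ and A₂ over the same alphabet Σ = V^n, there exists a hl-TOPL automaton B over Σ with L(B) = L(A₁)·L(A₂) = { w₁ w₂ | w₁ ∈ L(A₁), w₂ ∈ L(A₂) }. -/
namespace Topl

/-- Guards over `m` registers and letters that are `n`-tuples. -/
inductive Guard (m n : ℕ) : Type
  | eq : Fin m → Fin n → Guard m n
  | neq : Fin m → Fin n → Guard m n
  | tt : Guard m n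
  | and : Guard m n → Guard m n → Guard m n
  deriving DecidableEq

/-- Actions over `m` registers and letters that are `n`-tuples. -/
inductive Action (m n : ℕ) : Type
  | nop : Action m n
  | set : Fin m → Fin n → Action m n
  | seq : Action m n → Action m n → Action m n
  deriving DecidableEq

/-- Satisfaction of a guard by a store `s` and a letter `ℓ`. -/
def Guard.Sat {V : Type} {m n : ℕ} (s : Fin m → V) (ℓ : Fin n → V) : Guard m n → Prop
  | .eq i j => s i = ℓ j
  | .neq i j => s i ≠ ℓ j
  | .tt => True
  | .and g₁ g₂ => Guard.Sat s ℓ g₁ ∧ Guard.Sat s ℓ g₂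

/-- The store transformation of an action on input letter `ℓ`:
`nop(ℓ)(s) = s`, `(set i := j)(ℓ)(s) = s[i ↦ ℓ(j)]`, `(a₁;a₂)(ℓ) = a₁(ℓ) ∘ a₂(ℓ)`. -/
def Action.run {V : Type} {m n : ℕ} (ℓ : Fin n → V) : Action m n → (Fin m → V) → (Fin m → V)
  | .nop, s => s
  | .set i j, s => Function.update s i (ℓ j)
  | .seq a₁ a₂, s => Action.run ℓ a₁ (Action.run ℓ a₂ s)

/-- A TOPL automaton with `m` registers over `n`-tuples, whose set of states is `Fin k`. -/
structure TOPL (V : Type) (m n k : ℕ) where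
  q₀ : Fin k
  s₀ : Fin m → V
  δ : Finset (Fin k × (Guard m n × Action m n) × Fin k)
  F : Finset (Fin k)

namespace TOPL

variable {V : Type} {m n k : ℕ}

/-- One edge of the configuration graph, labelled by a letter. -/
def Step (A : TOPL V m n k) (x₁ : Fin k × (Fin m → V)) (ℓ : Fin n → V)
    (x₂ : Fin k × (Fin m → V)) : Prop :=
  ∃ g a, (x₁.1, (g, a), x₂.1) ∈ A.δ ∧ Guard.Sat x₁.2 ℓ g ∧ Action.run ℓ a x₁.2 = x₂.2

/-- Walks in the configuration graph, labelled by words. -/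
inductive Reach (A : TOPL V m n k) :
    Fin k × (Fin m → V) → List (Fin n → V) → Fin k × (Fin m → V) → Prop
  | nil (x) : Reach A x [] x
  | cons {x₁ x₂ x₃ ℓ w} : A.Step x₁ ℓ x₂ → Reach A x₂ w x₃ → Reach A x₁ (ℓ :: w) x₃

/-- The language of a TOPL automaton: words labelling walks from the initial
configuration to a configuration whose state is final. -/
def Lang (A : TOPL V m n k) : Set (List (Fin n → V)) :=
  { w | ∃ x, A.Reach (A.q₀, A.s₀) w x ∧ x.1 ∈ A.F }

end TOPL

/-- A high-level TOPL automaton: transitions are labelled by finite sequences of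
guard–action pairs. -/
structure HlTOPL (V : Type) (m n k : ℕ) where
  q₀ : Fin k
  s₀ : Fin m → V
  δ : Finset (Fin k × List (Guard m n × Action m n) × Fin k)
  F : Finset (Fin k)

namespace HlTOPL

variable {V : Type} {m n k : ℕ}

/-- `SeqAccept s gas w s'` holds when the TOPL automaton `T(s; gas)` accepts the word `w`
ending with store `s'`. -/
inductive SeqAccept {V : Type} {m n : ℕ} :
    (Fin m → V) → List (Guard m n × Action m n) → List (Fin n → V) → (Fin m → V) → Prop
  | nil (s) : SeqAccept s [] [] s
  | cons {s s' g a gas ℓ w} : Guard.Sat s ℓ g → SeqAccept (Action.run ℓ a s) gas w s' →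
      SeqAccept s ((g, a) :: gas) (ℓ :: w) s'

/-- A standard transition starts from the hl-configuration `(x, v)`. -/
def StdFrom (A : HlTOPL V m n k) (x : Fin k × (Fin m → V)) (v : List (Fin n → V)) : Prop :=
  ∃ q₂ s₂ gas u u', v = u ++ u' ∧ (x.1, gas, q₂) ∈ A.δ ∧ SeqAccept x.2 gas u s₂

/-- One edge of the hl-configuration graph: a standard transition or a skip transition. -/
inductive HlStep (A : HlTOPL V m n k) :
    (Fin k × (Fin m → V)) × List (Fin n → V) → List (Fin n → V) →
    (Fin k × (Fin m → V)) × List (Fin n → V) → Prop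
  | std {q₁ s₁ q₂ s₂ gas w w'} : (q₁, gas, q₂) ∈ A.δ → SeqAccept s₁ gas w s₂ →
      HlStep A ((q₁, s₁), w ++ w') w ((q₂, s₂), w')
  | skip {q s ℓ w} : ¬ A.StdFrom (q, s) (ℓ :: w) → HlStep A ((q, s), ℓ :: w) [ℓ] ((q, s), w)

/-- Paths in the hl-configuration graph, labelled by the concatenation of the step labels. -/
inductive Path (A : HlTOPL V m n k) :
    (Fin k × (Fin m → V)) × List (Fin n → V) → List (Fin n → V) →
    (Fin k × (Fin m → V)) × List (Fin n → V) → Prop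
  | nil (y) : Path A y [] y
  | cons {y₁ y₂ y₃ u w} : A.HlStep y₁ u y₂ → Path A y₂ w y₃ → Path A y₁ (u ++ w) y₃

/-- The language of a high-level TOPL automaton: words labelling paths from an initial
hl-configuration to a final one. -/
def Lang (A : HlTOPL V m n k) : Set (List (Fin n → V)) :=
  { w | ∃ (w₀ : List (Fin n → V)) (q : Fin k) (s : Fin m → V),
      A.Path ((A.q₀, A.s₀), w₀) w ((q, s), ([] : List (Fin n → V))) ∧ q ∈ A.F }

end HlTOPL

/-- Satisfaction of a guard, given the equality pattern between registers and letter components. -/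
def Guard.SatPattern {m n : ℕ} (P : Fin m → Fin n → Prop) : Guard m n → Prop
  | .eq i j => P i j
  | .neq i j => ¬ P i j
  | .tt => True
  | .and g₁ g₂ => SatPattern P g₁ ∧ SatPattern P g₂

theorem Guard.satPattern_iff {V : Type} {m n : ℕ} (s : Fin m → V) (ℓ : Fin n → V)
    (g : Guard m n) : g.SatPattern (fun i j => s i = ℓ j) ↔ g.Sat s ℓ := by
  induction g with
  | eq | neq | tt => rfl
  | and g₁ g₂ h₁ h₂ => simp [SatPattern, Sat, h₁, h₂]

/-- Where the content of each register comes from after an action: from a register or from a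
component of the letter. -/
def Action.source {m n : ℕ} : Action m n → Fin m → Fin m ⊕ Fin n
  | .nop => Sum.inl
  | .set i j => Function.update Sum.inl i (Sum.inr j)
  | .seq a₁ a₂ => fun i => Sum.elim (source a₂) Sum.inr (source a₁ i)

theorem Action.elim_source {V : Type} {m n : ℕ} (ℓ : Fin n → V) (a : Action m n)
    (s : Fin m → V) (i : Fin m) : Sum.elim s ℓ (a.source i) = a.run ℓ s i := by
  induction a generalizing s i with
  | nop => rfl
  | set i' j =>
    by_cases h : i = i'
    · subst h; simp [source, run]
    · simp [source, run, h]
  | seq a₁ a₂ h₁ h₂ =>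
    simp only [source, run]
    rw [← h₁]
    cases a₁.source i with
    | inl i' => simpa using h₂ s i'
    | inr j => rfl

/-- Every equality pattern is described by a guard. -/
theorem Guard.exists_pattern {V : Type} {m n : ℕ} (P : Fin m → Fin n → Prop) :
    ∃ g : Guard m n, ∀ (s : Fin m → V) (ℓ : Fin n → V),
      g.Sat s ℓ ↔ (fun i j => s i = ℓ j) = P := by
  classical
  have key : ∀ S : Finset (Fin m × Fin n), ∃ g : Guard m n, ∀ (s : Fin m → V) (ℓ : Fin n → V),
      g.Sat s ℓ ↔ ∀ p ∈ S, (s p.1 = ℓ p.2 ↔ P p.1 p.2) := by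
    intro S
    induction S using Finset.induction_on with
    | empty => exact ⟨.tt, by simp [Sat]⟩
    | insert p S _ ih =>
      obtain ⟨g, hg⟩ := ih
      by_cases hp : P p.1 p.2
      · exact ⟨.and (.eq p.1 p.2) g, fun s ℓ => by
          rw [Finset.forall_mem_insert, ← hg]; simp [Sat, hp]⟩
      · exact ⟨.and (.neq p.1 p.2) g, fun s ℓ => by
          rw [Finset.forall_mem_insert, ← hg]; simp [Sat, hp]⟩
  obtain ⟨g, hg⟩ := key Finset.univ
  refine ⟨g, fun s ℓ => (hg s ℓ).trans ?_⟩
  simp [funext_iff]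

/-- Every parallel assignment of letter components to registers is performed by an action. -/
theorem Action.exists_assign {V : Type} {m n : ℕ} (W : Fin m → Option (Fin n)) :
    ∃ a : Action m n, ∀ (ℓ : Fin n → V) (s : Fin m → V),
      a.run ℓ s = fun i => (W i).elim (s i) ℓ := by
  classical
  have key : ∀ S : Finset (Fin m), ∃ a : Action m n, ∀ (ℓ : Fin n → V) (s : Fin m → V),
      a.run ℓ s = fun i => if i ∈ S then (W i).elim (s i) ℓ else s i := by
    intro S
    induction S using Finset.induction_on with
    | empty => exact ⟨.nop, by simp [run]⟩
    | insert k S hk ih =>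
      obtain ⟨a, ha⟩ := ih
      cases hW : W k with
      | none =>
        refine ⟨a, fun ℓ s => ?_⟩
        rw [ha]
        funext i
        by_cases hi : i = k
        · subst hi; simp [hW]
        · simp [hi]
      | some j =>
        refine ⟨.seq (.set k j) a, fun ℓ s => ?_⟩
        funext i
        by_cases hi : i = k
        · subst hi; simp [run, hW]
        · simp [run, ha, hi]
  obtain ⟨a, ha⟩ := key Finset.univ
  exact ⟨a, by simpa using ha⟩

namespace HlTOPL

variable {V : Type} {m n k : ℕ}

/-- Acceptance of a word from a configuration of a high-level TOPL automaton. -/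
inductive Accepts (A : HlTOPL V m n k) : Fin k → (Fin m → V) → List (Fin n → V) → Prop
  | nil {q s} : q ∈ A.F → Accepts A q s []
  | std {q s q' s' gas u v} : (q, gas, q') ∈ A.δ → SeqAccept s gas u s' → Accepts A q' s' v →
      Accepts A q s (u ++ v)
  | skip {q s ℓ v} : ¬ A.StdFrom (q, s) (ℓ :: v) → Accepts A q s v → Accepts A q s (ℓ :: v)

theorem Path.accepts {A : HlTOPL V m n k} {y y' : (Fin k × (Fin m → V)) × List (Fin n → V)}
    {w : List (Fin n → V)} (h : A.Path y w y') (hy : y'.2 = []) (hF : y'.1.1 ∈ A.F) :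
    w = y.2 ∧ A.Accepts y.1.1 y.1.2 w := by
  induction h with
  | nil y => rw [hy]; exact ⟨rfl, .nil hF⟩
  | cons hs _ ih =>
    obtain ⟨rfl, h⟩ := ih hy hF
    cases hs with
    | std hδ hseq => exact ⟨rfl, .std hδ hseq h⟩
    | skip hn => exact ⟨rfl, .skip hn h⟩

theorem Accepts.path {A : HlTOPL V m n k} {q : Fin k} {s : Fin m → V} {w : List (Fin n → V)}
    (h : A.Accepts q s w) :
    ∃ (q' : Fin k) (s' : Fin m → V), A.Path ((q, s), w) w ((q', s'), []) ∧ q' ∈ A.F := by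
  induction h with
  | nil hF => exact ⟨_, _, .nil _, hF⟩
  | std hδ hseq _ ih =>
    obtain ⟨q', s', hp, hF⟩ := ih
    exact ⟨q', s', .cons (.std hδ hseq) hp, hF⟩
  | skip hn _ ih =>
    obtain ⟨q', s', hp, hF⟩ := ih
    exact ⟨q', s', .cons (.skip hn) hp, hF⟩

theorem mem_lang_iff (A : HlTOPL V m n k) (w : List (Fin n → V)) :
    w ∈ A.Lang ↔ A.Accepts A.q₀ A.s₀ w := by
  constructor
  · rintro ⟨w₀, q, s, hp, hF⟩
    exact (hp.accepts rfl hF).2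
  · intro h
    obtain ⟨q, s, hp, hF⟩ := h.path
    exact ⟨w, q, s, hp, hF⟩

end HlTOPL

/-- A register automaton with silent transitions and without skips, whose letter transitions may
inspect the whole equality pattern between registers and letter, and whose updates may copy
registers. -/
structure CopyAutomaton (V : Type) (n : ℕ) (C I : Type) where
  c₀ : C
  x₀ : I → V
  silent : C → C → Prop
  letter : C → (I → Fin n → Prop) → (I → I ⊕ Fin n) → C → Prop
  final : C → Prop

namespace CopyAutomaton

variable {V : Type} {n : ℕ} {C I : Type}

/-- Acceptance of a word from a configuration of a copying register automaton. -/
inductive Accepts (M : CopyAutomaton V n C I) : C → (I → V) → List (Fin n → V) → Prop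
  | nil {c x} : M.final c → Accepts M c x []
  | silent {c c' x w} : M.silent c c' → Accepts M c' x w → Accepts M c x w
  | letter {c c' x w ℓ P u} : M.letter c P u c' → (fun i j => x i = ℓ j) = P →
      Accepts M c' (fun i => Sum.elim x ℓ (u i)) w → Accepts M c x (ℓ :: w)

/-- Fresh registers for the components of a letter: an update with copying can be realised by
redirecting pointers and writing to registers that are not in use. -/
theorem exists_pointers [Fintype I] (σ : I → Fin (Fintype.card I + n)) (u : I → I ⊕ Fin n) :
    ∃ (σ' : I → Fin (Fintype.card I + n)) (W : Fin (Fintype.card I + n) → Option (Fin n)),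
      (∀ i i', u i = .inl i' → σ' i = σ i' ∧ W (σ i') = none) ∧
      (∀ i j, u i = .inr j → W (σ' i) = some j) := by
  classical
  have hcard : Fintype.card (Fin n) ≤ Fintype.card {r // r ∉ Finset.univ.image σ} := by
    rw [Fintype.card_subtype_compl, Fintype.card_fin, Fintype.card_fin, Fintype.card_coe]
    have := Finset.card_image_le (s := Finset.univ) (f := σ)
    rw [Finset.card_univ] at this
    omega
  obtain ⟨φ⟩ := Function.Embedding.nonempty_of_card_le hcard
  have hφ : Function.Injective fun j => (φ j : Fin (Fintype.card I + n)) :=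
    Subtype.val_injective.comp φ.injective
  refine ⟨fun i => Sum.elim σ (fun j => (φ j : Fin _)) (u i),
    fun r => if h : ∃ j, (φ j : Fin _) = r then some h.choose else none, ?_, ?_⟩
  · intro i i' h
    refine ⟨by simp [h], ?_⟩
    refine dif_neg ?_
    rintro ⟨j, hj⟩
    exact (φ j).2 (by simp [hj])
  · intro i j h
    have hex : ∃ j', (φ j' : Fin (Fintype.card I + n)) = φ j := ⟨j, rfl⟩
    simp only [h, Sum.elim_inr]
    rw [dif_pos hex]
    exact congrArg some (hφ hex.choose_spec)

/-- Every copying register automaton is equivalent to a high-level TOPL automaton. -/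
theorem exists_hlTOPL [Nonempty V] [Finite C] [Finite I] (M : CopyAutomaton V n C I) :
    ∃ (m k : ℕ) (B : HlTOPL V m n k), ∀ w, w ∈ B.Lang ↔ M.Accepts M.c₀ M.x₀ w := by
  classical
  have := Fintype.ofFinite C
  have := Fintype.ofFinite I
  obtain ⟨m, hm⟩ : ∃ m, m = Fintype.card I + n := ⟨_, rfl⟩
  have hptr : ∀ (σ : I → Fin m) (u : I → I ⊕ Fin n),
      ∃ (σ' : I → Fin m) (W : Fin m → Option (Fin n)),
        (∀ i i', u i = .inl i' → σ' i = σ i' ∧ W (σ i') = none) ∧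
        (∀ i j, u i = .inr j → W (σ' i) = some j) := by
    subst hm
    exact exists_pointers
  let e : C × (I → Fin m) ≃ Fin (Fintype.card (C × (I → Fin m))) := Fintype.equivFin _
  choose γ hγ using Guard.exists_pattern (V := V) (m := m) (n := n)
  choose α hα using Action.exists_assign (V := V) (m := m) (n := n)
  let label : Option ((Fin m → Fin n → Prop) × (Fin m → Option (Fin n))) →
      List (Guard m n × Action m n) := fun o => o.elim [] fun t => [(γ t.1, α t.2)]
  let enabled : Set (Option ((Fin m → Fin n → Prop) × (Fin m → Option (Fin n))) ×
      (C × (I → Fin m)) × (C × (I → Fin m))) := fun t =>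
    match t with
    | (none, (c, σ), (c', σ')) => σ = σ' ∧ (c = c' ∨ M.silent c c')
    | (some (P, W), (c, σ), (c', σ')) => ∃ u, M.letter c (fun i => P (σ i)) u c' ∧
        (∀ i i', u i = .inl i' → σ' i = σ i' ∧ W (σ i') = none) ∧
        (∀ i j, u i = .inr j → W (σ' i) = some j)
  obtain ⟨σ₀, hσ₀⟩ : ∃ σ₀ : I → Fin m, Function.Injective σ₀ := by
    subst hm
    exact ⟨fun i => Fin.castAdd n (Fintype.equivFin I i),
      (Fin.castAdd_injective _ _).comp (Fintype.equivFin I).injective⟩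
  obtain ⟨s₀, hs₀⟩ : ∃ s₀ : Fin m → V, ∀ i, s₀ (σ₀ i) = M.x₀ i := by
    obtain ⟨v⟩ := ‹Nonempty V›
    exact ⟨Function.extend σ₀ M.x₀ fun _ => v, fun i => hσ₀.extend_apply _ _ i⟩
  let B : HlTOPL V m n (Fintype.card (C × (I → Fin m))) :=
    { q₀ := e (M.c₀, σ₀)
      s₀ := s₀
      δ := (Set.toFinite ((fun t => (e t.2.1, label t.1, e t.2.2)) '' enabled)).toFinset
      F := Finset.univ.filter fun q => M.final (e.symm q).1 }
  have hδ : ∀ a l b, (e a, l, e b) ∈ B.δ ↔ ∃ o, (o, a, b) ∈ enabled ∧ label o = l := by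
    intro a l b
    simp only [B, Set.Finite.mem_toFinset, Set.mem_image, Prod.mk.injEq, Prod.exists]
    constructor
    · rintro ⟨o, c, σ, c', σ', h, h₁, h₂, h₃⟩
      obtain rfl := e.injective h₁
      obtain rfl := e.injective h₃
      exact ⟨o, h, h₂⟩
    · rintro ⟨o, h, h₂⟩
      exact ⟨o, _, _, _, _, h, rfl, h₂, rfl⟩
  have hF : ∀ a, e a ∈ B.F ↔ M.final a.1 := by simp [B]
  have sound : ∀ q s w, B.Accepts q s w →
      M.Accepts (e.symm q).1 (fun i => s ((e.symm q).2 i)) w := by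
    intro q s w h
    induction h with
    | @nil q s h =>
      rw [← e.apply_symm_apply q, hF] at h
      exact .nil h
    | @std q s q' s' gas u v h hseq _ ih =>
      generalize ha : e.symm q = a at ih ⊢
      generalize hb : e.symm q' = b at ih ⊢
      rw [← e.apply_symm_apply q, ← e.apply_symm_apply q', ha, hb, hδ] at h
      obtain ⟨c, σ⟩ := a
      obtain ⟨c', σ'⟩ := b
      obtain ⟨_ | ⟨P, W⟩, h, rfl⟩ := h
      · cases hseq
        obtain ⟨rfl, rfl | h⟩ := h
        · exact ih
        · exact .silent h ih
      · obtain ⟨u, h, h₁, h₂⟩ := h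
        cases hseq with
        | cons hg hseq =>
        cases hseq
        rw [hγ] at hg
        subst hg
        refine .letter h rfl ?_
        change M.Accepts c' _ v
        convert ih using 1
        funext i
        rw [hα]
        rcases hu : u i with i' | j
        · obtain ⟨h₃, h₄⟩ := h₁ i i' hu
          simp [h₃, h₄]
        · simp [h₂ i j hu]
    | @skip q s ℓ v h _ _ =>
      refine absurd ⟨q, s, [], [], ℓ :: v, rfl, ?_, .nil _⟩ h
      rw [← e.apply_symm_apply q, hδ]
      exact ⟨none, ⟨rfl, .inl rfl⟩, rfl⟩
  have complete : ∀ c x w, M.Accepts c x w → ∀ (σ : I → Fin m) (s : Fin m → V),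
      (∀ i, s (σ i) = x i) → B.Accepts (e (c, σ)) s w := by
    intro c x w h
    induction h with
    | nil h => exact fun σ s _ => .nil ((hF _).2 h)
    | @silent c c' x w h _ ih =>
      intro σ s hx
      exact .std (u := []) ((hδ (c, σ) [] (c', σ)).2 ⟨none, ⟨rfl, .inr h⟩, rfl⟩) (.nil s)
        (ih σ s hx)
    | @letter c c' x w ℓ P u h hP _ ih =>
      intro σ s hx
      obtain ⟨σ', W, h₁, h₂⟩ := hptr σ u
      refine .std (u := [ℓ]) ((hδ (c, σ) _ (c', σ')).2
        ⟨some (fun i j => s i = ℓ j, W), ⟨u, ?_, h₁, h₂⟩, rfl⟩)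
        (.cons ((hγ _ _ _).2 rfl) (.nil _)) (ih σ' _ ?_)
      · simpa only [hx, hP] using h
      · intro i
        rw [hα]
        rcases hu : u i with i' | j
        · obtain ⟨h₃, h₄⟩ := h₁ i i' hu
          simp [hu, h₃, h₄, hx]
        · simp [hu, h₂ i j hu]
  refine ⟨m, _, B, fun w => ?_⟩
  rw [HlTOPL.mem_lang_iff]
  constructor
  · intro h
    simpa [B, hs₀] using sound _ _ _ h
  · exact fun h => complete _ _ _ h _ _ hs₀

/-- The concatenation of two copying register automata. -/
def concat {C₁ I₁ C₂ I₂ : Type} (M₁ : CopyAutomaton V n C₁ I₁) (M₂ : CopyAutomaton V n C₂ I₂) :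
    CopyAutomaton V n (C₁ ⊕ C₂) (I₁ ⊕ I₂) where
  c₀ := .inl M₁.c₀
  x₀ := Sum.elim M₁.x₀ M₂.x₀
  silent
    | .inl c, .inl c' => M₁.silent c c'
    | .inl c, .inr c' => M₁.final c ∧ c' = M₂.c₀
    | .inr _, .inl _ => False
    | .inr c, .inr c' => M₂.silent c c'
  letter
    | .inl c, P, u, .inl c' => ∃ u₁, M₁.letter c (fun i => P (.inl i)) u₁ c' ∧
        u = Sum.elim (fun i => (u₁ i).map .inl id) (fun i => .inl (.inr i))
    | .inr c, P, u, .inr c' => ∃ u₂, M₂.letter c (fun i => P (.inr i)) u₂ c' ∧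
        u = Sum.elim (fun i => .inl (.inl i)) (fun i => (u₂ i).map .inr id)
    | _, _, _, _ => False
  final := Sum.elim (fun _ => False) M₂.final

variable {C₁ I₁ C₂ I₂ : Type} {M₁ : CopyAutomaton V n C₁ I₁} {M₂ : CopyAutomaton V n C₂ I₂}

theorem Accepts.of_concat {c : C₁ ⊕ C₂} {x : I₁ ⊕ I₂ → V} {w : List (Fin n → V)}
    (h : (M₁.concat M₂).Accepts c x w) :
    match c with
    | .inl c => (fun i => x (.inr i)) = M₂.x₀ → ∃ w₁ w₂,
        M₁.Accepts c (fun i => x (.inl i)) w₁ ∧ M₂.Accepts M₂.c₀ M₂.x₀ w₂ ∧ w = w₁ ++ w₂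
    | .inr c => M₂.Accepts c (fun i => x (.inr i)) w := by
  induction h with
  | @nil c x h =>
    rcases c with c | c
    · exact h.elim
    · exact .nil h
  | @silent c c' x w h _ ih =>
    rcases c with c | c <;> rcases c' with c' | c'
    · intro hx
      obtain ⟨w₁, w₂, h₁, h₂, rfl⟩ := ih hx
      exact ⟨w₁, w₂, .silent h h₁, h₂, rfl⟩
    · intro hx
      obtain ⟨h, rfl⟩ := h
      exact ⟨[], w, .nil h, hx ▸ ih, rfl⟩
    · exact h.elim
    · exact .silent h ih
  | @letter c c' x w ℓ P u h hP _ ih =>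
    subst hP
    rcases c with c | c <;> rcases c' with c' | c'
    · intro hx
      obtain ⟨u₁, h, rfl⟩ := h
      obtain ⟨w₁, w₂, h₁, h₂, rfl⟩ := ih hx
      refine ⟨ℓ :: w₁, w₂, .letter h rfl ?_, h₂, rfl⟩
      convert h₁ using 2 with i
      cases hu : u₁ i <;> simp [hu]
    · exact h.elim
    · exact h.elim
    · obtain ⟨u₂, h, rfl⟩ := h
      refine .letter h rfl ?_
      convert ih using 2 with i
      cases hu : u₂ i <;> simp [hu]

theorem Accepts.concat_right {c : C₂} {x : I₂ → V} {w : List (Fin n → V)}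
    (h : M₂.Accepts c x w) (x₁ : I₁ → V) :
    (M₁.concat M₂).Accepts (.inr c) (Sum.elim x₁ x) w := by
  induction h with
  | nil h => exact .nil h
  | silent h _ ih => exact .silent (c' := Sum.inr _) h ih
  | @letter c c' x w ℓ P u h hP _ ih =>
    refine .letter (c' := Sum.inr c') ⟨u, by simpa [hP] using h, rfl⟩ rfl ?_
    convert ih using 1
    funext i
    rcases i with i | i
    · simp
    · cases hu : u i <;> simp [hu]

theorem Accepts.concat_left {c : C₁} {x : I₁ → V} {w w' : List (Fin n → V)}
    (h : M₁.Accepts c x w) (h' : M₂.Accepts M₂.c₀ M₂.x₀ w') :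
    (M₁.concat M₂).Accepts (.inl c) (Sum.elim x M₂.x₀) (w ++ w') := by
  induction h with
  | nil h => exact .silent (c' := Sum.inr _) ⟨h, rfl⟩ (h'.concat_right _)
  | silent h _ ih => exact .silent (c' := Sum.inl _) h ih
  | @letter c c' x w ℓ P u h hP _ ih =>
    refine .letter (c' := Sum.inl c') ⟨u, by simpa [hP] using h, rfl⟩ rfl ?_
    change (M₁.concat M₂).Accepts _ _ (w ++ w')
    convert ih using 1
    funext i
    rcases i with i | i
    · cases hu : u i <;> simp [hu]
    · simp

theorem concat_accepts_iff (w : List (Fin n → V)) :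
    (M₁.concat M₂).Accepts (M₁.concat M₂).c₀ (M₁.concat M₂).x₀ w ↔
      ∃ w₁ w₂, M₁.Accepts M₁.c₀ M₁.x₀ w₁ ∧ M₂.Accepts M₂.c₀ M₂.x₀ w₂ ∧ w = w₁ ++ w₂ := by
  constructor
  · exact fun h => h.of_concat rfl
  · rintro ⟨w₁, w₂, h₁, h₂, rfl⟩
    exact h₁.concat_left h₂

end CopyAutomaton

namespace HlTOPL

variable {V : Type} {m n k : ℕ}

/-- No prefix of `v` is accepted by the sequence `gas` from the store `s`. -/
def Fails (s : Fin m → V) (gas : List (Guard m n × Action m n)) (v : List (Fin n → V)) : Prop :=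
  ∀ u u' s', v = u ++ u' → ¬ SeqAccept s gas u s'

theorem not_fails_nil (s : Fin m → V) (v : List (Fin n → V)) : ¬ Fails s [] v :=
  fun h => h [] v s rfl (.nil s)

theorem fails_of_ne_nil (s : Fin m → V) {gas : List (Guard m n × Action m n)} (h : gas ≠ []) :
    Fails s gas [] := by
  intro u u' s' huv hseq
  cases hseq with
  | nil => exact h rfl
  | cons => simp at huv

theorem fails_cons_iff (s : Fin m → V) (ga : Guard m n × Action m n)
    (gas : List (Guard m n × Action m n)) (ℓ : Fin n → V) (v : List (Fin n → V)) :
    Fails s (ga :: gas) (ℓ :: v) ↔ (ga.1.Sat s ℓ → Fails (ga.2.run ℓ s) gas v) := by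
  constructor
  · rintro h hg u u' s' rfl hseq
    exact h (ℓ :: u) u' s' rfl (.cons hg hseq)
  · intro h u u' s' huv hseq
    cases hseq with
    | cons hg hseq =>
      obtain ⟨rfl, rfl⟩ := List.cons.inj huv
      exact h hg _ _ _ rfl hseq

theorem not_stdFrom_iff (A : HlTOPL V m n k) (q : Fin k) (s : Fin m → V)
    (v : List (Fin n → V)) :
    ¬ A.StdFrom (q, s) v ↔ ∀ t ∈ A.δ, t.1 = q → Fails s t.2.1 v := by
  constructor
  · rintro h ⟨_, gas, q'⟩ ht rfl u u' s' huv hseq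
    exact h ⟨q', s', gas, u, u', huv, ht, hseq⟩
  · rintro h ⟨q', s', gas, u, u', huv, ht, hseq⟩
    exact h _ ht rfl u u' s' huv hseq

/-- A bound on the lengths of the labels of transitions. -/
def depth (A : HlTOPL V m n k) : ℕ := A.δ.sup fun t => t.2.1.length

theorem length_le_depth (A : HlTOPL V m n k) (t : {t // t ∈ A.δ}) :
    t.1.2.1.length ≤ A.depth :=
  Finset.le_sup (f := fun t : Fin k × List (Guard m n × Action m n) × Fin k => t.2.1.length) t.2

/-- The main control of the skip-free simulation of `A`: at a state of `A`, or inside a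
transition of `A`, of which some guard-action pairs have been processed. -/
abbrev Control (A : HlTOPL V m n k) : Type :=
  Fin k ⊕ ({t // t ∈ A.δ} × Fin (A.depth + 1))

/-- The threads of the skip-free simulation of `A`. The thread `(t, p)` monitors that `t`, of which
`p + 1` guard-action pairs have been processed since some skip, does not complete. -/
abbrev Thread (A : HlTOPL V m n k) : Type := {t // t ∈ A.δ} × Fin A.depth

/-- Whether an attempt of the transition `t` that has processed `r` pairs is to be monitored. -/
def Active {A : HlTOPL V m n k} (c : A.Control) (O : A.Thread → Prop) (t : {t // t ∈ A.δ}) :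
    ℕ → Prop
  | 0 => c = .inl t.1.1
  | r + 1 => ∃ h : r < A.depth, O (t, ⟨r, h⟩)

/-- The thread that holds the store of an attempt of `t` that has processed `r` pairs; an attempt
that has not started uses the main store. -/
def holder (A : HlTOPL V m n k) (t : {t // t ∈ A.δ}) : ℕ → Option A.Thread
  | 0 => none
  | r + 1 => if h : r < A.depth then some (t, ⟨r, h⟩) else none

/-- The `r`-th guard-action pair of a transition. -/
def pair {A : HlTOPL V m n k} (t : {t // t ∈ A.δ}) (r : ℕ) : Guard m n × Action m n :=
  t.1.2.1.getD r (.tt, .nop)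

theorem drop_eq_pair_cons {A : HlTOPL V m n k} (t : {t // t ∈ A.δ}) {r : ℕ}
    (h : r < t.1.2.1.length) : t.1.2.1.drop r = pair t r :: t.1.2.1.drop (r + 1) := by
  rw [List.drop_eq_getElem_cons h, pair, List.getD_eq_getElem _ _ h]

/-- Silent moves of the main control. -/
inductive ControlSilent (A : HlTOPL V m n k) : A.Control → A.Control → Prop
  | start (t) : ControlSilent A (.inl t.1.1) (.inr (t, 0))
  | finish (t) (p : Fin (A.depth + 1)) : p.val = t.1.2.1.length →
      ControlSilent A (.inr (t, p)) (.inl t.1.2.2)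

/-- Letter moves of the main control. -/
inductive ControlLetter (A : HlTOPL V m n k) :
    A.Control → (Fin m → Fin n → Prop) → (Fin m → Fin m ⊕ Fin n) → A.Control → Prop
  | skip (q P) : ControlLetter A (.inl q) P .inl (.inl q)
  | read (t P) (p r : Fin (A.depth + 1)) : p.val < t.1.2.1.length → r.val = p.val + 1 →
      (pair t p).1.SatPattern P →
      ControlLetter A (.inr (t, p)) P (pair t p).2.source (.inr (t, r))

/-- The monitored threads after a letter. -/
def nextThreads {A : HlTOPL V m n k} (c : A.Control) (O : A.Thread → Prop)
    (P : Option A.Thread × Fin m → Fin n → Prop) (κ : A.Thread) : Prop :=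
  Active c O κ.1 κ.2 ∧ (pair κ.1 κ.2).1.SatPattern fun i => P (A.holder κ.1 κ.2, i)

/-- The update of the stores of all threads after a letter, given that of the main store. -/
def nextSource (A : HlTOPL V m n k) (u : Fin m → Fin m ⊕ Fin n) :
    Option A.Thread × Fin m → (Option A.Thread × Fin m) ⊕ Fin n
  | (none, i) => (u i).map (fun i => (none, i)) id
  | (some κ, i) => ((pair κ.1 κ.2).2.source i).map (fun i => (A.holder κ.1 κ.2, i)) id

/-- The skip-free simulation of a high-level TOPL automaton. -/
def skipFree (A : HlTOPL V m n k) :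
    CopyAutomaton V n (A.Control × (A.Thread → Prop)) (Option A.Thread × Fin m) where
  c₀ := (.inl A.q₀, fun _ => False)
  x₀ i := A.s₀ i.2
  silent c c' := A.ControlSilent c.1 c'.1 ∧ c'.2 = c.2
  letter c P u c' :=
    (∀ t r, Active c.1 c.2 t r → r < t.1.2.1.length) ∧
    c'.2 = nextThreads c.1 c.2 P ∧
    ∃ u₀, A.ControlLetter c.1 (fun i => P (none, i)) u₀ c'.1 ∧ u = A.nextSource u₀
  final c := (∃ q ∈ A.F, c.1 = .inl q) ∧ ∀ t (p : Fin A.depth), c.2 (t, p) →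
    p.val + 1 < t.1.2.1.length

/-- All attempts monitored by threads fail on the word `v`. -/
def ThreadsFail {A : HlTOPL V m n k} (O : A.Thread → Prop) (x : Option A.Thread × Fin m → V)
    (v : List (Fin n → V)) : Prop :=
  ∀ κ, O κ → Fails (fun i => x (some κ, i)) (κ.1.1.2.1.drop (κ.2.val + 1)) v

/-- All monitored attempts, including those that would start now, fail on the word `v`. -/
def ActiveFail {A : HlTOPL V m n k} (c : A.Control) (O : A.Thread → Prop)
    (x : Option A.Thread × Fin m → V) (v : List (Fin n → V)) : Prop :=
  ∀ t r, Active c O t r → Fails (fun i => x (A.holder t r, i)) (t.1.2.1.drop r) v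

theorem activeFail_iff {A : HlTOPL V m n k} (c : A.Control) (O : A.Thread → Prop)
    (x : Option A.Thread × Fin m → V) (v : List (Fin n → V)) :
    ActiveFail c O x v ↔ ThreadsFail O x v ∧
      ∀ q, c = .inl q → ¬ A.StdFrom (q, fun i => x (none, i)) v := by
  constructor
  · intro h
    refine ⟨fun κ hκ => ?_, ?_⟩
    · have := h κ.1 (κ.2.val + 1) ⟨κ.2.2, hκ⟩
      simpa [holder] using this
    · rintro q rfl
      rw [not_stdFrom_iff]
      rintro t ht rfl
      exact h ⟨t, ht⟩ 0 rfl
  · rintro ⟨h₁, h₂⟩ t (_ | r) hr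
    · exact (not_stdFrom_iff ..).1 (h₂ _ hr) t.1 t.2 rfl
    · obtain ⟨hlt, hr⟩ := hr
      simpa [holder, hlt] using h₁ _ hr

theorem elim_nextSource_none {A : HlTOPL V m n k} (u : Fin m → Fin m ⊕ Fin n)
    (x : Option A.Thread × Fin m → V) (ℓ : Fin n → V) (i : Fin m) :
    Sum.elim x ℓ (A.nextSource u (none, i)) = Sum.elim (fun i => x (none, i)) ℓ (u i) := by
  cases h : u i <;> simp [nextSource, h]

theorem elim_nextSource_some {A : HlTOPL V m n k} (u : Fin m → Fin m ⊕ Fin n)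
    (x : Option A.Thread × Fin m → V) (ℓ : Fin n → V) (κ : A.Thread) (i : Fin m) :
    Sum.elim x ℓ (A.nextSource u (some κ, i)) =
      (pair κ.1 κ.2).2.run ℓ (fun i => x (A.holder κ.1 κ.2, i)) i := by
  rw [← Action.elim_source]
  cases h : (pair κ.1 κ.2).2.source i <;> simp [nextSource, h]

theorem activeFail_cons_iff {A : HlTOPL V m n k} (c : A.Control) (O : A.Thread → Prop)
    (x : Option A.Thread × Fin m → V) (ℓ : Fin n → V) (v : List (Fin n → V))
    (u : Fin m → Fin m ⊕ Fin n) :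
    ActiveFail c O x (ℓ :: v) ↔ (∀ t r, Active c O t r → r < t.1.2.1.length) ∧
      ThreadsFail (nextThreads c O fun i j => x i = ℓ j)
        (fun i => Sum.elim x ℓ (A.nextSource u i)) v := by
  constructor
  · intro h
    have hlt : ∀ t r, Active c O t r → r < t.1.2.1.length := by
      intro t r hr
      by_contra hn
      have := h t r hr
      rw [List.drop_eq_nil_of_le (not_lt.1 hn)] at this
      exact not_fails_nil _ _ this
    refine ⟨hlt, ?_⟩
    rintro ⟨t, p⟩ ⟨hact, hsat⟩
    have := h t p hact
    rw [drop_eq_pair_cons t (hlt t p hact), fails_cons_iff] at this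
    simp only [elim_nextSource_some]
    exact this ((Guard.satPattern_iff _ _ _).1 hsat)
  · rintro ⟨hlt, h⟩ t r hr
    have hr' := hlt t r hr
    rw [drop_eq_pair_cons t hr', fails_cons_iff]
    intro hsat
    have := h (t, ⟨r, hr'.trans_le (A.length_le_depth t)⟩)
      ⟨hr, (Guard.satPattern_iff _ _ _).2 hsat⟩
    simpa only [elim_nextSource_some] using this

/-- Acceptance by `A` from a main control state of its simulation. -/
def ControlAccepts (A : HlTOPL V m n k) (s : Fin m → V) (v : List (Fin n → V)) :
    A.Control → Prop
  | .inl q => A.Accepts q s v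
  | .inr (t, p) => ∃ u u' s', v = u ++ u' ∧ SeqAccept s (t.1.2.1.drop p) u s' ∧
      A.Accepts t.1.2.2 s' u'

theorem skipFree_sound {A : HlTOPL V m n k} {c : A.Control × (A.Thread → Prop)}
    {x : Option A.Thread × Fin m → V} {v : List (Fin n → V)} (h : A.skipFree.Accepts c x v) :
    A.ControlAccepts (fun i => x (none, i)) v c.1 ∧ ThreadsFail c.2 x v := by
  induction h with
  | @nil c x h =>
    obtain ⟨c, O⟩ := c
    obtain ⟨⟨q, hq, rfl⟩, h⟩ := h
    refine ⟨.nil hq, fun κ hκ => fails_of_ne_nil _ ?_⟩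
    have := h κ.1 κ.2 hκ
    simpa using this
  | @silent c c' x v h _ ih =>
    obtain ⟨c, O⟩ := c
    obtain ⟨c', O'⟩ := c'
    obtain ⟨h, rfl⟩ := h
    refine ⟨?_, ih.2⟩
    cases h with
    | start t =>
      obtain ⟨u, u', s', rfl, hseq, hacc⟩ := ih.1
      exact .std t.2 hseq hacc
    | finish t p hp =>
      refine ⟨[], v, _, rfl, ?_, ih.1⟩
      rw [hp, List.drop_length]
      exact .nil _
  | @letter c c' x v ℓ P u h hP _ ih =>
    subst hP
    obtain ⟨c, O⟩ := c
    obtain ⟨c', O'⟩ := c'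
    obtain ⟨hlt, rfl, u₀, h, rfl⟩ := h
    have hact := (activeFail_iff ..).1 ((activeFail_cons_iff c O x ℓ v u₀).2 ⟨hlt, ih.2⟩)
    refine ⟨?_, hact.1⟩
    have ih₁ := ih.1
    simp only [elim_nextSource_none] at ih₁
    cases h with
    | skip q => exact .skip (hact.2 q rfl) ih₁
    | read t _ p p' hp hp' hsat =>
      obtain ⟨w, w', s', rfl, hseq, hacc⟩ := ih₁
      refine ⟨ℓ :: w, w', s', rfl, ?_, hacc⟩
      rw [drop_eq_pair_cons t hp]
      refine .cons ((Guard.satPattern_iff _ _ _).1 hsat) ?_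
      simp only [Action.elim_source, hp'] at hseq
      exact hseq

theorem skipFree_complete_seq {A : HlTOPL V m n k} {s s' : Fin m → V}
    {gas : List (Guard m n × Action m n)} {u v : List (Fin n → V)} (t : {t // t ∈ A.δ})
    (h : SeqAccept s gas u s')
    (hv : ∀ (O : A.Thread → Prop) (x : Option A.Thread × Fin m → V),
      (∀ i, x (none, i) = s' i) → ThreadsFail O x v → A.skipFree.Accepts (.inl t.1.2.2, O) x v)
    (p : Fin (A.depth + 1)) (hp : p.val ≤ t.1.2.1.length) (hgas : gas = t.1.2.1.drop p)
    (O : A.Thread → Prop) (x : Option A.Thread × Fin m → V) (hx : ∀ i, x (none, i) = s i)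
    (hO : ThreadsFail O x (u ++ v)) : A.skipFree.Accepts (.inr (t, p), O) x (u ++ v) := by
  induction h generalizing p O x with
  | nil s =>
    have hlen : p.val = t.1.2.1.length := le_antisymm hp (List.drop_eq_nil_iff.1 hgas.symm)
    exact .silent (c' := (.inl t.1.2.2, O)) ⟨.finish t p hlen, rfl⟩ (hv O x hx hO)
  | @cons s s' g a gas ℓ w hg _ ih =>
    have hlt : p.val < t.1.2.1.length := by
      by_contra hn
      rw [List.drop_eq_nil_of_le (not_lt.1 hn)] at hgas
      cases hgas
    rw [drop_eq_pair_cons t hlt] at hgas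
    obtain ⟨hga, rfl⟩ := List.cons.inj hgas
    have hbound := A.length_le_depth t
    obtain ⟨hact, hO'⟩ := (activeFail_cons_iff (.inr (t, p)) O x ℓ (w ++ v)
      (pair t p).2.source).1 ((activeFail_iff ..).2 ⟨hO, by simp⟩)
    have hs : (fun i => x (none, i)) = s := funext hx
    refine .letter (c' := (.inr (t, ⟨p.val + 1, by omega⟩), _))
      ⟨hact, rfl, _, .read t _ p _ hlt rfl ?_, rfl⟩ rfl
      (ih hv ⟨p.val + 1, by omega⟩ hlt rfl _ _ ?_ hO')
    · rw [Guard.satPattern_iff, hs, ← hga]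
      exact hg
    · intro i
      rw [elim_nextSource_none, Action.elim_source, hs, ← hga]

theorem skipFree_complete {A : HlTOPL V m n k} {q : Fin k} {s : Fin m → V}
    {v : List (Fin n → V)} (h : A.Accepts q s v) (O : A.Thread → Prop)
    (x : Option A.Thread × Fin m → V) (hx : ∀ i, x (none, i) = s i) (hO : ThreadsFail O x v) :
    A.skipFree.Accepts (.inl q, O) x v := by
  induction h generalizing O x with
  | nil hq =>
    refine .nil ⟨⟨_, hq, rfl⟩, fun t p hp => ?_⟩
    by_contra hn
    have := hO _ hp
    rw [List.drop_eq_nil_of_le (not_lt.1 hn)] at this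
    exact not_fails_nil _ _ this
  | @std q s q' s' gas u v ht hseq _ ih =>
    exact .silent (c' := (.inr (⟨_, ht⟩, 0), O)) ⟨.start ⟨_, ht⟩, rfl⟩
      (skipFree_complete_seq ⟨_, ht⟩ hseq ih 0 (Nat.zero_le _) rfl O x hx hO)
  | @skip q s ℓ v hn _ ih =>
    have hs : (fun i => x (none, i)) = s := funext hx
    obtain ⟨hact, hO'⟩ := (activeFail_cons_iff (.inl q) O x ℓ v .inl).1
      ((activeFail_iff ..).2 ⟨hO, by
        rintro _ ⟨⟩
        rwa [hs]⟩)
    refine .letter (c' := (.inl q, _)) ⟨hact, rfl, _, .skip q _, rfl⟩ rfl (ih _ _ ?_ hO')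
    intro i
    rw [elim_nextSource_none]
    exact hx i

theorem skipFree_accepts_iff (A : HlTOPL V m n k) (w : List (Fin n → V)) :
    A.skipFree.Accepts A.skipFree.c₀ A.skipFree.x₀ w ↔ w ∈ A.Lang := by
  rw [mem_lang_iff]
  exact ⟨fun h => (skipFree_sound h).1,
    fun h => skipFree_complete h _ _ (fun _ => rfl) (fun _ h => h.elim)⟩

end HlTOPL

/-- hl-TOPL-recognizable languages are closed under concatenation. -/
theorem hlTopl_closed_under_concatenation (V : Type) [Infinite V] (n : ℕ)
    (m₁ k₁ m₂ k₂ : ℕ) (A₁ : HlTOPL V m₁ n k₁) (A₂ : HlTOPL V m₂ n k₂) :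
    ∃ (m k : ℕ) (B : HlTOPL V m n k),
      B.Lang = { w | ∃ w₁ w₂, w₁ ∈ A₁.Lang ∧ w₂ ∈ A₂.Lang ∧ w = w₁ ++ w₂ } := by
  obtain ⟨m, k, B, hB⟩ := (A₁.skipFree.concat A₂.skipFree).exists_hlTOPL
  refine ⟨m, k, B, Set.ext fun w => ?_⟩
  rw [hB, CopyAutomaton.concat_accepts_iff]
  simp only [HlTOPL.skipFree_accepts_iff, Set.mem_ofPred_eq]

end Topl
end

section
/- The emptiness problem for TOPL automata is decidable: taking V = ℕ (so that automata admit finite descriptions and equality of values is decidable), the set of TOPL automata A over V^n whose language L(A) is empty is a computable (decidable) predicate on (codes of) automata. -/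
namespace Topl

/-- A (code for a) guard: a finite conjunction of literals `(b, i, j)`, where `b = true`
means `eq i j` (register `i` equals component `j` of the letter), `b = false` means
`neq i j`, and the empty conjunction is the guard `true`. -/
abbrev GuardC : Type := List (Bool × ℕ × ℕ)

/-- A (code for an) action: a finite sequence of assignments `set i := j`;
the empty sequence is `nop`. -/
abbrev ActionC : Type := List (ℕ × ℕ)

/-- A code for a TOPL automaton over `V = ℕ`, with `m` registers, arity `n`,
states `{0, …, k−1}`, initial state `q0`, initial store `s0`,
transition list `delta` and final states `F`. -/
structure ToplC where
  m : ℕ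
  n : ℕ
  k : ℕ
  q0 : ℕ
  s0 : List ℕ
  delta : List (ℕ × (GuardC × ActionC) × ℕ)
  F : List ℕ

def toplCEquiv : ToplC ≃ ℕ × ℕ × ℕ × ℕ × List ℕ × List (ℕ × (GuardC × ActionC) × ℕ) × List ℕ where
  toFun A := (A.m, A.n, A.k, A.q0, A.s0, A.delta, A.F)
  invFun p := ⟨p.1, p.2.1, p.2.2.1, p.2.2.2.1, p.2.2.2.2.1, p.2.2.2.2.2.1, p.2.2.2.2.2.2⟩
  left_inv A := rfl
  right_inv p := rfl

instance : Primcodable ToplC := Primcodable.ofEquiv _ toplCEquiv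

/-- Satisfaction of a guard by a store `s` and a letter `ℓ` (both given as lists). -/
def GuardC.Sat (s ℓ : List ℕ) (g : GuardC) : Prop :=
  ∀ p ∈ g, (p.1 = true → s.getD p.2.1 0 = ℓ.getD p.2.2 0) ∧
           (p.1 = false → s.getD p.2.1 0 ≠ ℓ.getD p.2.2 0)

/-- The store transformation of an action on input letter `ℓ`. -/
def ActionC.run (ℓ : List ℕ) (a : ActionC) (s : List ℕ) : List ℕ :=
  a.foldl (fun s p => s.set p.1 (ℓ.getD p.2 0)) s

/-- One edge of the configuration graph. -/
def ToplC.Step (A : ToplC) (x₁ : ℕ × List ℕ) (ℓ : List ℕ) (x₂ : ℕ × List ℕ) : Prop :=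
  ∃ g a, (x₁.1, (g, a), x₂.1) ∈ A.delta ∧ GuardC.Sat x₁.2 ℓ g ∧ ActionC.run ℓ a x₁.2 = x₂.2

/-- Walks in the configuration graph, labelled by words. -/
inductive ToplC.Reach (A : ToplC) : ℕ × List ℕ → List (List ℕ) → ℕ × List ℕ → Prop
  | nil (x) : ToplC.Reach A x [] x
  | cons {x₁ x₂ x₃ ℓ w} : A.Step x₁ ℓ x₂ → ToplC.Reach A x₂ w x₃ → ToplC.Reach A x₁ (ℓ :: w) x₃

/-- The language of a coded TOPL automaton: words over the alphabet `ℕ^n`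
(letters are lists of length `n`) labelling walks from the initial configuration
to a configuration whose state is final. -/
def ToplC.Lang (A : ToplC) : Set (List (List ℕ)) :=
  { w | (∀ ℓ ∈ w, ℓ.length = A.n) ∧ ∃ x, A.Reach (A.q0, A.s0) w x ∧ x.1 ∈ A.F }

/-- Well-formedness: the code really describes a TOPL automaton with `m` registers over
`n`-tuples and `k` states. -/
def ToplC.WF (A : ToplC) : Prop :=
  A.q0 < A.k ∧ A.s0.length = A.m ∧ (∀ q ∈ A.F, q < A.k) ∧
  ∀ t ∈ A.delta, t.1 < A.k ∧ t.2.2 < A.k ∧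
    (∀ p ∈ t.2.1.1, p.2.1 < A.m ∧ p.2.2 < A.n) ∧
    (∀ p ∈ t.2.1.2, p.1 < A.m ∧ p.2 < A.n)

/-- All words over the alphabet `ℕ^n`. -/
def fullLang (n : ℕ) : Set (List (List ℕ)) := { w | ∀ ℓ ∈ w, ℓ.length = n }

open Primrec Encodable

/-- A transition of a coded automaton. -/
abbrev TransC : Type := ℕ × (GuardC × ActionC) × ℕ

theorem primrec_toplCEquiv : Primrec toplCEquiv := Primrec.of_equiv

theorem primrec_m : Primrec ToplC.m :=
  (fst.comp primrec_toplCEquiv).of_eq fun _ => rfl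

theorem primrec_n : Primrec ToplC.n :=
  ((fst.comp snd).comp primrec_toplCEquiv).of_eq fun _ => rfl

theorem primrec_k : Primrec ToplC.k :=
  ((fst.comp <| snd.comp snd).comp primrec_toplCEquiv).of_eq fun _ => rfl

theorem primrec_q0 : Primrec ToplC.q0 :=
  ((fst.comp <| snd.comp <| snd.comp snd).comp primrec_toplCEquiv).of_eq fun _ => rfl

theorem primrec_s0 : Primrec ToplC.s0 :=
  ((fst.comp <| snd.comp <| snd.comp <| snd.comp snd).comp primrec_toplCEquiv).of_eq fun _ => rfl

theorem primrec_delta : Primrec ToplC.delta :=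
  ((fst.comp <| snd.comp <| snd.comp <| snd.comp <| snd.comp snd).comp primrec_toplCEquiv).of_eq
    fun _ => rfl

theorem primrec_F : Primrec ToplC.F :=
  ((snd.comp <| snd.comp <| snd.comp <| snd.comp <| snd.comp snd).comp primrec_toplCEquiv).of_eq
    fun _ => rfl

theorem primrecPred_mem {α β : Type*} [Primcodable α] [Primcodable β] {f : α → β} {g : α → List β}
    (hf : Primrec f) (hg : Primrec g) : PrimrecPred fun a => f a ∈ g a :=
  ((PrimrecRel.exists_mem_list (R := fun b c : β => b = c) Primrec.eq).comp hg hf).of_eq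
    fun a => by simp

theorem primrecPred_wf : PrimrecPred ToplC.WF := by
  have hlt : PrimrecRel fun a b : ℕ => a < b := nat_lt
  have hguard : PrimrecRel fun (p : Bool × ℕ × ℕ) (A : ToplC) => p.2.1 < A.m ∧ p.2.2 < A.n :=
    (nat_lt.comp (fst.comp <| snd.comp fst) (primrec_m.comp snd)).and
      (nat_lt.comp (snd.comp <| snd.comp fst) (primrec_n.comp snd))
  have hact : PrimrecRel fun (p : ℕ × ℕ) (A : ToplC) => p.1 < A.m ∧ p.2 < A.n :=
    (nat_lt.comp (fst.comp fst) (primrec_m.comp snd)).and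
      (nat_lt.comp (snd.comp fst) (primrec_n.comp snd))
  have htrans : PrimrecRel fun (t : TransC) (A : ToplC) => t.1 < A.k ∧ t.2.2 < A.k ∧
      (∀ p ∈ t.2.1.1, p.2.1 < A.m ∧ p.2.2 < A.n) ∧ (∀ p ∈ t.2.1.2, p.1 < A.m ∧ p.2 < A.n) :=
    (nat_lt.comp (fst.comp fst) (primrec_k.comp snd)).and <|
      (nat_lt.comp (snd.comp <| snd.comp fst) (primrec_k.comp snd)).and <|
      (hguard.forall_mem_list.comp (fst.comp <| fst.comp <| snd.comp fst) snd).and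
      (hact.forall_mem_list.comp (snd.comp <| fst.comp <| snd.comp fst) snd)
  exact (nat_lt.comp primrec_q0 primrec_k).and <|
    (Primrec.eq.comp (list_length.comp primrec_s0) primrec_m).and <|
    (hlt.forall_mem_list.comp primrec_F primrec_k).and
    (htrans.forall_mem_list.comp primrec_delta .id)

theorem primrecPred_sat :
    PrimrecPred fun p : GuardC × List ℕ × List ℕ => GuardC.Sat p.2.1 p.2.2 p.1 := by
  have hlit : PrimrecRel fun (p : Bool × ℕ × ℕ) (x : List ℕ × List ℕ) =>
      (p.1 = true → x.1.getD p.2.1 0 = x.2.getD p.2.2 0) ∧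
        (p.1 = false → x.1.getD p.2.1 0 ≠ x.2.getD p.2.2 0) := by
    have hs : Primrec fun y : (Bool × ℕ × ℕ) × List ℕ × List ℕ => y.2.1.getD y.1.2.1 0 :=
      (list_getD 0).comp (fst.comp snd) (fst.comp <| snd.comp fst)
    have hl : Primrec fun y : (Bool × ℕ × ℕ) × List ℕ × List ℕ => y.2.2.getD y.1.2.2 0 :=
      (list_getD 0).comp (snd.comp snd) (snd.comp <| snd.comp fst)
    have ht : PrimrecPred fun y : (Bool × ℕ × ℕ) × List ℕ × List ℕ => y.1.1 = true :=
      Primrec.eq.comp (fst.comp fst) (const true)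
    have he := Primrec.eq.comp hs hl
    refine PrimrecPred.of_eq ((ht.and he).or (ht.not.and he.not)) fun y => ?_
    rcases y with ⟨⟨b, i, j⟩, s, l⟩
    cases b <;> simp
  exact hlit.forall_mem_list.comp fst snd

theorem primrec_run :
    Primrec fun p : ActionC × List ℕ × List ℕ => ActionC.run p.2.1 p.1 p.2.2 := by
  unfold ActionC.run
  refine list_foldl fst (snd.comp snd)
    (h := fun (p : ActionC × List ℕ × List ℕ) (x : List ℕ × ℕ × ℕ) =>
      x.1.set x.2.1 (p.2.1.getD x.2.2 0)) ?_
  exact list_set.comp (fst.comp snd) (pair (fst.comp <| snd.comp snd)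
    ((list_getD 0).comp (fst.comp <| snd.comp fst) (snd.comp <| snd.comp snd)))

open Classical in
/-- Fire a given transition on a given letter, if it is enabled. -/
noncomputable def ToplC.fire (A : ToplC) (x : ℕ × List ℕ) (e : TransC × List ℕ) :
    Option (ℕ × List ℕ) :=
  if e.2.length = A.n ∧ e.1 ∈ A.delta ∧ e.1.1 = x.1 ∧ GuardC.Sat x.2 e.2 e.1.2.1.1 then
    some (e.1.2.2, ActionC.run e.2 e.1.2.1.2 x.2) else none

/-- Fire a list of transitions labelled by letters. -/
noncomputable def ToplC.fireAll (A : ToplC) (x : ℕ × List ℕ) (W : List (TransC × List ℕ)) :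
    Option (ℕ × List ℕ) :=
  W.foldl (fun o e => o.bind fun y => A.fire y e) (some x)

theorem primrec_fire :
    Primrec fun p : ToplC × (ℕ × List ℕ) × TransC × List ℕ => p.1.fire p.2.1 p.2.2 := by
  have hA : Primrec fun p : ToplC × (ℕ × List ℕ) × TransC × List ℕ => p.1 := fst
  have hq : Primrec fun p : ToplC × (ℕ × List ℕ) × TransC × List ℕ => p.2.1.1 :=
    fst.comp <| fst.comp snd
  have hs : Primrec fun p : ToplC × (ℕ × List ℕ) × TransC × List ℕ => p.2.1.2 :=
    snd.comp <| fst.comp snd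
  have ht : Primrec fun p : ToplC × (ℕ × List ℕ) × TransC × List ℕ => p.2.2.1 :=
    fst.comp <| snd.comp snd
  have hl : Primrec fun p : ToplC × (ℕ × List ℕ) × TransC × List ℕ => p.2.2.2 :=
    snd.comp <| snd.comp snd
  have hg : Primrec fun p : ToplC × (ℕ × List ℕ) × TransC × List ℕ => p.2.2.1.2.1.1 :=
    (fst.comp <| fst.comp <| snd.comp ht).of_eq fun _ => rfl
  have ha : Primrec fun p : ToplC × (ℕ × List ℕ) × TransC × List ℕ => p.2.2.1.2.1.2 :=
    (snd.comp <| fst.comp <| snd.comp ht).of_eq fun _ => rfl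
  have hn : Primrec fun p : ToplC × (ℕ × List ℕ) × TransC × List ℕ => p.1.n :=
    (primrec_n.comp hA).of_eq fun _ => rfl
  have hd : Primrec fun p : ToplC × (ℕ × List ℕ) × TransC × List ℕ => p.1.delta :=
    (primrec_delta.comp hA).of_eq fun _ => rfl
  have hsat := primrecPred_sat.comp (hg.pair (hs.pair hl))
  have hc := (Primrec.eq.comp (list_length.comp hl) hn).and <|
    (primrecPred_mem ht hd).and <| (Primrec.eq.comp (fst.comp ht) hq).and hsat
  have hr := option_some.comp <| (snd.comp <| snd.comp ht).pair
    (primrec_run.comp (ha.pair (hl.pair hs)))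
  classical
  refine (Primrec.ite hc hr (const none)).of_eq fun p => ?_
  unfold ToplC.fire
  congr

theorem primrec_fireAll :
    Primrec fun p : ToplC × List (TransC × List ℕ) => p.1.fireAll (p.1.q0, p.1.s0) p.2 := by
  have hA : Primrec fun p : ToplC × List (TransC × List ℕ) => p.1 := fst
  have h0 := option_some.comp <| (primrec_q0.comp hA).pair (primrec_s0.comp hA)
  have hx : Primrec fun y : ((ToplC × List (TransC × List ℕ)) ×
      Option (ℕ × List ℕ) × TransC × List ℕ) => y.2.1 := fst.comp snd
  have hb : Primrec fun z : (((ToplC × List (TransC × List ℕ)) ×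
      Option (ℕ × List ℕ) × TransC × List ℕ) × (ℕ × List ℕ)) => z.1.1.1.fire z.2 z.1.2.2 :=
    (primrec_fire.comp ((fst.comp <| fst.comp fst).pair
      (snd.pair (snd.comp <| snd.comp fst)))).of_eq fun _ => rfl
  exact (list_foldl snd h0 (option_bind hx hb.to₂).to₂).of_eq fun _ => rfl

/-- The number `c` codes a run from the initial configuration to a final state. -/
def ToplC.Accepting (A : ToplC) (c : ℕ) : Prop :=
  ∃ W ∈ (decode c : Option (List (TransC × List ℕ))),
    ∃ x ∈ A.fireAll (A.q0, A.s0) W, x.1 ∈ A.F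

theorem primrecRel_accepting : PrimrecRel fun (c : ℕ) (A : ToplC) => A.Accepting c := by
  have hd : Primrec fun p : ℕ × ToplC => (decode p.1 : Option (List (TransC × List ℕ))) :=
    Primrec.decode.comp fst
  have hw : Primrec fun z : (ℕ × ToplC) × List (TransC × List ℕ) =>
      z.1.2.fireAll (z.1.2.q0, z.1.2.s0) z.2 :=
    (primrec_fireAll.comp ((snd.comp fst).pair snd)).of_eq fun _ => rfl
  have h := option_bind hd hw.to₂
  have hF : PrimrecPred fun y : (ℕ × List ℕ) × ToplC => y.1.1 ∈ y.2.F :=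
    primrecPred_mem (fst.comp fst) (primrec_F.comp snd)
  have hF' : PrimrecRel fun (x : ℕ × List ℕ) (A : ToplC) => x.1 ∈ A.F := hF
  refine PrimrecPred.of_eq (hF'.exists_mem_list.comp (optionToList.comp h) snd) fun p => ?_
  simp only [ToplC.Accepting, Option.mem_toList, Option.mem_def, Option.bind_eq_some_iff]
  constructor
  · rintro ⟨x, ⟨W, h1, h2⟩, h3⟩
    exact ⟨W, h1, x, h2, h3⟩
  · rintro ⟨W, h1, x, h2, h3⟩
    exact ⟨x, ⟨W, h1, h2⟩, h3⟩

/-- An upper bound for the codes of lists of length at most `L` whose entries have codes at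
most `C`. -/
def listBound (L C : ℕ) : ℕ := encode (List.replicate L C)

theorem pair_le_pair {a b c d : ℕ} (h : a ≤ c) (h' : b ≤ d) : Nat.pair a b ≤ Nat.pair c d :=
  (StrictMono.monotone (fun _ _ => Nat.pair_lt_pair_left b) h).trans
    (StrictMono.monotone (fun _ _ => Nat.pair_lt_pair_right c) h')

theorem encode_le_listBound {α : Type*} [Encodable α] {L C : ℕ} {l : List α}
    (hL : l.length ≤ L) (hC : ∀ a ∈ l, encode a ≤ C) : encode l ≤ listBound L C := by
  induction l generalizing L with
  | nil => simp
  | cons a l ih =>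
    obtain ⟨L, rfl⟩ : ∃ L', L = L' + 1 := ⟨L - 1, by simp at hL; omega⟩
    have h1 := ih (L := L) (by simpa using hL) fun b hb => hC b (by simp [hb])
    have h2 := hC a (by simp)
    simp only [listBound, List.replicate_succ, encode_list_cons] at h1 ⊢
    exact Nat.succ_le_succ (pair_le_pair h2 h1)

theorem encode_le_of_mem {α : Type*} [Encodable α] {l : List α} {a : α} (h : a ∈ l) :
    encode a ≤ encode l := by
  induction l with
  | nil => simp at h
  | cons b l ih =>
    rw [encode_list_cons]
    rcases List.mem_cons.1 h with rfl | h
    · exact (Nat.left_le_pair _ _).trans (Nat.le_succ _)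
    · exact (ih h).trans ((Nat.right_le_pair _ _).trans (Nat.le_succ _))

theorem primrec_listBound : Primrec₂ listBound := by
  have h : Primrec fun p : ℕ × ℕ => (List.range p.1).map fun _ => p.2 :=
    list_map (list_range.comp fst) (snd.comp fst)
  refine (Primrec.encode.comp h).of_eq fun p => ?_
  simp [listBound, List.map_const']

/-- Values below this bound suffice for witnessing non-emptiness. -/
def ToplC.valueBound (A : ToplC) : ℕ := encode A.s0 + A.m + A.n + 1

/-- The codes of configurations with small values are at most this. -/
def ToplC.configBound (A : ToplC) : ℕ := Nat.pair A.k (listBound A.m A.valueBound)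

/-- The codes of short runs with small values are at most this. -/
def ToplC.runBound (A : ToplC) : ℕ :=
  listBound (A.configBound + 1) (Nat.pair (encode A.delta) (listBound A.n A.valueBound))

theorem primrec_valueBound : Primrec ToplC.valueBound :=
  succ.comp <| nat_add.comp (nat_add.comp (Primrec.encode.comp primrec_s0) primrec_m) primrec_n

theorem primrec_configBound : Primrec ToplC.configBound :=
  Primrec₂.natPair.comp primrec_k (primrec_listBound.comp primrec_m primrec_valueBound)

theorem primrec_runBound : Primrec ToplC.runBound :=
  primrec_listBound.comp (succ.comp primrec_configBound) <|
    Primrec₂.natPair.comp (Primrec.encode.comp primrec_delta)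
      (primrec_listBound.comp primrec_n primrec_valueBound)

theorem ToplC.fire_eq_some {A : ToplC} {x y : ℕ × List ℕ} {e : TransC × List ℕ} :
    A.fire x e = some y ↔ e.2.length = A.n ∧ e.1 ∈ A.delta ∧ e.1.1 = x.1 ∧
      GuardC.Sat x.2 e.2 e.1.2.1.1 ∧ (e.1.2.2, ActionC.run e.2 e.1.2.1.2 x.2) = y := by
  unfold ToplC.fire
  split_ifs with h
  · simp only [Option.some.injEq]
    tauto
  · simp only [false_iff]
    tauto

theorem ToplC.fireAll_nil (A : ToplC) (x : ℕ × List ℕ) : A.fireAll x [] = some x := rfl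

theorem ToplC.fireAll_append (A : ToplC) (x : ℕ × List ℕ) (W W' : List (TransC × List ℕ)) :
    A.fireAll x (W ++ W') = (A.fireAll x W).bind fun y => A.fireAll y W' := by
  unfold ToplC.fireAll
  rw [List.foldl_append]
  cases W.foldl (fun o e => o.bind fun y => A.fire y e) (some x) with
  | some y => rfl
  | none => induction W' <;> simp_all

theorem ToplC.fireAll_singleton (A : ToplC) (x : ℕ × List ℕ) (e : TransC × List ℕ) :
    A.fireAll x [e] = A.fire x e := rfl

theorem ToplC.fireAll_cons (A : ToplC) (x : ℕ × List ℕ) (e : TransC × List ℕ)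
    (W : List (TransC × List ℕ)) :
    A.fireAll x (e :: W) = (A.fire x e).bind fun y => A.fireAll y W := by
  rw [← A.fireAll_singleton, ← A.fireAll_append, List.singleton_append]

theorem ToplC.reach_of_fireAll {A : ToplC} {W : List (TransC × List ℕ)} {x y : ℕ × List ℕ}
    (h : A.fireAll x W = some y) :
    ∃ w, (∀ l ∈ w, l.length = A.n) ∧ A.Reach x w y := by
  induction W generalizing x with
  | nil =>
    obtain rfl : x = y := by simpa [ToplC.fireAll_nil] using h
    exact ⟨[], by simp, .nil x⟩
  | cons e W ih =>
    rw [ToplC.fireAll_cons, Option.bind_eq_some_iff] at h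
    obtain ⟨z, hz, hy⟩ := h
    obtain ⟨w, hw, hr⟩ := ih hy
    obtain ⟨hl, hd, hq, hs, rfl⟩ := ToplC.fire_eq_some.1 hz
    refine ⟨e.2 :: w, by simpa [hl] using hw, .cons ⟨e.1.2.1.1, e.1.2.1.2, ?_, hs, rfl⟩ hr⟩
    rwa [← hq]

/-- All values occurring in the letters of a run are below `B`. -/
def SmallRun (B : ℕ) (W : List (TransC × List ℕ)) : Prop := ∀ e ∈ W, ∀ v ∈ e.2, v < B

theorem exists_injOn_extend (B : ℕ) (l : List ℕ) (S : Finset ℕ) (f : ℕ → ℕ)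
    (hf : Set.InjOn f S) (hB : ∀ v ∈ S, f v < B) (hc : S.card + l.length ≤ B) :
    ∃ g : ℕ → ℕ, (∀ v ∈ S, g v = f v) ∧ Set.InjOn g {v | v ∈ S ∨ v ∈ l} ∧
      ∀ v, v ∈ S ∨ v ∈ l → g v < B := by
  induction l generalizing S f with
  | nil => exact ⟨f, fun _ _ => rfl, by simpa using hf, by simpa using hB⟩
  | cons a l ih =>
    simp only [List.length_cons] at hc
    by_cases ha : a ∈ S
    · obtain ⟨g, h1, h2, h3⟩ := ih S f hf hB (by omega)
      have hS : ∀ v, (v ∈ S ∨ v ∈ a :: l) ↔ (v ∈ S ∨ v ∈ l) := fun v => by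
        rw [List.mem_cons]
        constructor
        · rintro (h | rfl | h) <;> tauto
        · tauto
      simp only [hS]
      exact ⟨g, h1, h2, h3⟩
    · obtain ⟨b, hb, hbS⟩ : ∃ b ∈ Finset.range B, b ∉ S.image f := by
        by_contra! h
        have h1 := Finset.card_le_card (show Finset.range B ⊆ S.image f from h)
        have h2 := Finset.card_image_le (s := S) (f := f)
        rw [Finset.card_range] at h1
        omega
      have hne : ∀ v ∈ S, v ≠ a := fun v hv h => ha (h ▸ hv)
      have hup : ∀ v ∈ S, Function.update f a b v = f v := fun v hv => by simp [hne v hv]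
      obtain ⟨g, h1, h2, h3⟩ := ih (insert a S) (Function.update f a b)
        (by
          rw [Finset.coe_insert, Set.injOn_insert (by simpa using ha)]
          refine ⟨hf.congr fun v hv => (hup v hv).symm, ?_⟩
          rintro ⟨v, hv, h⟩
          rw [hup v hv, Function.update_self] at h
          exact hbS (Finset.mem_image.2 ⟨v, hv, h⟩))
        (by
          intro v hv
          rcases Finset.mem_insert.1 hv with rfl | hv
          · simpa using hb
          · rw [hup v hv]
            exact hB v hv)
        (by rw [Finset.card_insert_of_notMem ha]; omega)
      have hS : ∀ v, (v ∈ S ∨ v ∈ a :: l) ↔ (v ∈ insert a S ∨ v ∈ l) := fun v => by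
        rw [List.mem_cons, Finset.mem_insert]
        tauto
      simp only [hS]
      exact ⟨g, fun v hv => (h1 v (Finset.mem_insert_of_mem hv)).trans (hup v hv), h2, h3⟩

theorem getD_mem {s : List ℕ} {i : ℕ} (h : i < s.length) : s.getD i 0 ∈ s := by
  rw [List.getD_eq_getElem _ _ h]
  exact List.getElem_mem h

theorem getD_map {s : List ℕ} {i : ℕ} (f : ℕ → ℕ) (h : i < s.length) :
    (s.map f).getD i 0 = f (s.getD i 0) := by
  rw [List.getD_eq_getElem _ _ h, List.getD_eq_getElem _ _ (by simpa using h), List.getElem_map]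

theorem GuardC.Sat.map {s l : List ℕ} {g : GuardC} {f : ℕ → ℕ} (h : GuardC.Sat s l g)
    (hg : ∀ p ∈ g, p.2.1 < s.length ∧ p.2.2 < l.length)
    (hf : Set.InjOn f {v | v ∈ s ∨ v ∈ l}) : GuardC.Sat (s.map f) (l.map f) g := by
  intro p hp
  obtain ⟨hi, hj⟩ := hg p hp
  rw [getD_map f hi, getD_map f hj]
  refine ⟨fun hb => congrArg f ((h p hp).1 hb), fun hb he => (h p hp).2 hb ?_⟩
  exact hf (.inl (getD_mem hi)) (.inr (getD_mem hj)) he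

theorem ActionC.length_run (l : List ℕ) (a : ActionC) (s : List ℕ) :
    (ActionC.run l a s).length = s.length := by
  unfold ActionC.run
  induction a generalizing s with
  | nil => rfl
  | cons p a ih => rw [List.foldl_cons, ih, List.length_set]

theorem ActionC.mem_run {l : List ℕ} {a : ActionC} {s : List ℕ} (ha : ∀ p ∈ a, p.2 < l.length)
    {v : ℕ} (h : v ∈ ActionC.run l a s) : v ∈ s ∨ v ∈ l := by
  unfold ActionC.run at h
  induction a generalizing s with
  | nil => exact .inl h
  | cons p a ih =>
    rcases ih (fun p hp => ha p (by simp [hp])) h with h | h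
    · rcases List.mem_or_eq_of_mem_set h with h | rfl
      · exact .inl h
      · exact .inr (getD_mem (ha p (by simp)))
    · exact .inr h

theorem ActionC.run_map {l : List ℕ} {a : ActionC} (s : List ℕ) (ha : ∀ p ∈ a, p.2 < l.length)
    (f : ℕ → ℕ) : ActionC.run (l.map f) a (s.map f) = (ActionC.run l a s).map f := by
  unfold ActionC.run
  induction a generalizing s with
  | nil => rfl
  | cons p a ih =>
    simp only [List.foldl_cons]
    rw [getD_map f (ha p (by simp)), ← List.map_set]
    exact ih _ fun p hp => ha p (by simp [hp])

theorem ToplC.exists_smallRun {A : ToplC} (hA : A.WF) {B : ℕ} (hB : A.m + A.n ≤ B)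
    {x z : ℕ × List ℕ} {w : List (List ℕ)} (h : A.Reach x w z) (hw : ∀ l ∈ w, l.length = A.n)
    (hx : x.2.length = A.m) (f : ℕ → ℕ) (hf : Set.InjOn f {v | v ∈ x.2})
    (hfB : ∀ v ∈ x.2, f v < B) :
    ∃ W y, SmallRun B W ∧ A.fireAll (x.1, x.2.map f) W = some y ∧ y.1 = z.1 := by
  induction h generalizing f with
  | nil x => exact ⟨[], _, by simp [SmallRun], rfl, rfl⟩
  | @cons x₁ x₂ x₃ l w hs hr ih =>
    obtain ⟨g, a, hd, hg, ha⟩ := hs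
    obtain ⟨-, -, hgi, hai⟩ := hA.2.2.2 _ hd
    have hl : l.length = A.n := hw l (by simp)
    have hal : ∀ p ∈ a, p.2 < l.length := fun p hp => hl ▸ (hai p hp).2
    have hcard := List.toFinset_card_le x₁.2
    obtain ⟨f', h1, h2, h3⟩ := exists_injOn_extend B l x₁.2.toFinset f (by simpa using hf)
      (by simpa using hfB) (by omega)
    simp only [List.mem_toFinset] at h1 h2 h3
    have hmem : ∀ v ∈ x₂.2, v ∈ x₁.2 ∨ v ∈ l := fun v hv => ActionC.mem_run hal (ha ▸ hv)
    obtain ⟨W, y, hW, hy, hyz⟩ := ih (fun l hl => hw l (by simp [hl]))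
      (by rw [← ha, ActionC.length_run, hx]) f' (h2.mono hmem) (fun v hv => h3 v (hmem v hv))
    refine ⟨((x₁.1, (g, a), x₂.1), l.map f') :: W, y, ?_, ?_, hyz⟩
    · intro e he
      rcases List.mem_cons.1 he with rfl | he
      · simpa using fun v hv => h3 v (.inr hv)
      · exact hW e he
    · rw [ToplC.fireAll_cons, ← List.map_congr_left h1, Option.bind_eq_some_iff]
      refine ⟨_, ToplC.fire_eq_some.2 ⟨by simpa using hl, hd, rfl, hg.map ?_ h2, rfl⟩, ?_⟩
      · intro p hp
        rw [hx, hl]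
        exact hgi p hp
      · simp only [ActionC.run_map _ hal, ha]
        exact hy

theorem stabilises_of_encode_lt {α : Type*} [Encodable α] {R : ℕ → α → Prop} {C : ℕ}
    (hmono : ∀ n y, R n y → R (n + 1) y) (hC : ∀ n y, R n y → encode y < C)
    (hstab : ∀ n, (∀ y, R (n + 1) y → R n y) → ∀ y, R (n + 2) y → R (n + 1) y)
    {n : ℕ} {y : α} (h : R n y) : R C y := by
  classical
  let D (n : ℕ) : Finset ℕ := (Finset.range C).filter fun c => ∃ y, R n y ∧ encode y = c
  have hD : ∀ n y, encode y ∈ D n ↔ R n y := fun n y => by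
    simp only [D, Finset.mem_filter, Finset.mem_range]
    constructor
    · rintro ⟨-, z, hz, he⟩
      rwa [← encode_injective he]
    · exact fun h => ⟨hC n y h, y, h, rfl⟩
  have hDm : Monotone D := monotone_nat_of_le_succ fun n c hc => by
    simp only [D, Finset.mem_filter] at hc ⊢
    obtain ⟨h1, y, h2, h3⟩ := hc
    exact ⟨h1, y, hmono n y h2, h3⟩
  have key := Nat.stabilises_of_monotone (f := fun n => (D n).card) (b := C) (n := max n C)
    (fun i j hij => Finset.card_le_card (hDm hij))
    (fun n => (Finset.card_filter_le _ _).trans (by simp))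
    (fun n hn => by
      have he := Finset.eq_of_subset_of_card_le (hDm n.le_succ) hn.ge
      have h2 := hstab n fun y hy => by rwa [← hD, he, hD]
      congr 1
      refine (hDm (n + 1).le_succ).antisymm fun c hc => ?_
      obtain ⟨h1, y, h3, rfl⟩ := Finset.mem_filter.1 hc
      exact (hD _ _).2 (h2 y h3))
    (le_max_right _ _)
  have he := Finset.eq_of_subset_of_card_le (hDm (le_max_right n C)) key.le
  rw [← hD, he]
  exact hDm (le_max_left n C) ((hD n y).2 h)

theorem ToplC.encode_le_configBound {A : ToplC} (hA : A.WF) {W : List (TransC × List ℕ)}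
    (hW : SmallRun A.valueBound W) {x y : ℕ × List ℕ} (h : A.fireAll x W = some y)
    (hx : x.1 < A.k ∧ x.2.length = A.m ∧ ∀ v ∈ x.2, v < A.valueBound) :
    encode y ≤ A.configBound := by
  induction W generalizing x with
  | nil =>
    obtain rfl : x = y := by simpa [ToplC.fireAll_nil] using h
    exact pair_le_pair hx.1.le (encode_le_listBound hx.2.1.le fun v hv => (hx.2.2 v hv).le)
  | cons e W ih =>
    rw [ToplC.fireAll_cons, Option.bind_eq_some_iff] at h
    obtain ⟨z, hz, hy⟩ := h
    refine ih (fun e he => hW e (by simp [he])) hy ?_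
    obtain ⟨hl, hd, hq, hs, rfl⟩ := ToplC.fire_eq_some.1 hz
    obtain ⟨-, hk, -, hai⟩ := hA.2.2.2 _ hd
    refine ⟨hk, by rw [ActionC.length_run, hx.2.1], fun v hv => ?_⟩
    rcases ActionC.mem_run (fun p hp => hl ▸ (hai p hp).2) hv with hv | hv
    · exact hx.2.2 v hv
    · exact hW e (by simp) v hv

theorem ToplC.exists_shortRun {A : ToplC} (hA : A.WF) {x : ℕ × List ℕ}
    (hx : x.1 < A.k ∧ x.2.length = A.m ∧ ∀ v ∈ x.2, v < A.valueBound)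
    {W : List (TransC × List ℕ)} (hW : SmallRun A.valueBound W) {y : ℕ × List ℕ}
    (h : A.fireAll x W = some y) :
    ∃ W', SmallRun A.valueBound W' ∧ W'.length ≤ A.configBound + 1 ∧ A.fireAll x W' = some y := by
  let R (n : ℕ) (y : ℕ × List ℕ) : Prop :=
    ∃ W', SmallRun A.valueBound W' ∧ W'.length ≤ n ∧ A.fireAll x W' = some y
  refine stabilises_of_encode_lt (R := R) (n := W.length) ?_ ?_ ?_ ⟨W, hW, le_rfl, h⟩
  · rintro n y ⟨W', h1, h2, h3⟩
    exact ⟨W', h1, h2.trans n.le_succ, h3⟩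
  · rintro n y ⟨W', h1, -, h3⟩
    exact Nat.lt_succ_of_le (ToplC.encode_le_configBound hA h1 h3 hx)
  · rintro n hn y ⟨W', h1, h2, h3⟩
    rcases List.eq_nil_or_concat' W' with rfl | ⟨V, e, rfl⟩
    · exact ⟨[], h1, by simp, h3⟩
    · rw [ToplC.fireAll_append, Option.bind_eq_some_iff] at h3
      obtain ⟨z, hz, hy⟩ := h3
      obtain ⟨V', g1, g2, g3⟩ := hn z ⟨V, fun e he => h1 e (by simp [he]),
        by simpa using h2, hz⟩
      refine ⟨V' ++ [e], ?_, by simpa using g2, ?_⟩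
      · intro e' he
        rcases List.mem_append.1 he with he | he
        · exact g1 e' he
        · exact h1 e' (List.mem_append_right _ he)
      · rw [ToplC.fireAll_append, g3]
        exact hy

theorem ToplC.mem_delta_of_fireAll {A : ToplC} {W : List (TransC × List ℕ)} {x y : ℕ × List ℕ}
    (h : A.fireAll x W = some y) : ∀ e ∈ W, e.2.length = A.n ∧ e.1 ∈ A.delta := by
  induction W generalizing x with
  | nil => simp
  | cons e W ih =>
    rw [ToplC.fireAll_cons, Option.bind_eq_some_iff] at h
    obtain ⟨z, hz, hy⟩ := h
    obtain ⟨hl, hd, -⟩ := ToplC.fire_eq_some.1 hz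
    intro e' he
    rcases List.mem_cons.1 he with rfl | he
    · exact ⟨hl, hd⟩
    · exact ih hy e' he

theorem ToplC.lang_nonempty_iff {A : ToplC} (hA : A.WF) :
    A.Lang.Nonempty ↔ ∃ c < A.runBound + 1, A.Accepting c := by
  constructor
  · rintro ⟨w, hw, x, hr, hF⟩
    have hs0 : ∀ v ∈ A.s0, v < A.valueBound := fun v hv => by
      have : v ≤ encode A.s0 := encode_le_of_mem hv
      unfold ToplC.valueBound
      omega
    obtain ⟨W, y, hW, hy, hyx⟩ := ToplC.exists_smallRun hA (B := A.valueBound)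
      (by unfold ToplC.valueBound; omega) hr hw hA.2.1 id (Set.injOn_id _) hs0
    rw [List.map_id] at hy
    obtain ⟨W', g1, g2, g3⟩ := ToplC.exists_shortRun hA ⟨hA.1, hA.2.1, hs0⟩ hW hy
    refine ⟨encode W', Nat.lt_succ_of_le (encode_le_listBound g2 fun e he => ?_), W',
      encodek W', y, g3, hyx ▸ hF⟩
    obtain ⟨hl, hd⟩ := ToplC.mem_delta_of_fireAll g3 e he
    exact pair_le_pair (encode_le_of_mem hd)
      (encode_le_listBound hl.le fun v hv => (g1 e he v hv).le)
  · rintro ⟨c, -, W, -, x, hx, hF⟩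
    obtain ⟨w, hw, hr⟩ := ToplC.reach_of_fireAll hx
    exact ⟨w, hw, x, hr, hF⟩

theorem primrecPred_exists_accepting :
    PrimrecPred fun A : ToplC => ∃ c < A.runBound + 1, A.Accepting c := by
  have hb : Primrec fun A : ToplC => List.range (A.runBound + 1) :=
    list_range.comp (succ.comp primrec_runBound)
  exact (primrecRel_accepting.exists_mem_list.comp hb Primrec.id).of_eq fun A => by simp

/-- The emptiness problem for TOPL automata (over `V = ℕ`) is decidable: the set of
(codes of) well-formed TOPL automata whose language is empty is a computable predicate. -/
theorem topl_emptiness_decidable :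
    ComputablePred fun A : ToplC => A.WF ∧ A.Lang = ∅ := by
  have h := primrecPred_wf.and primrecPred_exists_accepting.not
  refine h.computablePred.of_eq fun A => and_congr_right fun hA => ?_
  rw [← ToplC.lang_nonempty_iff hA, Set.not_nonempty_iff_eq_empty]

end Topl
end
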